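/- For any ϱ ≥ 0 and α > 0, the identity c(α) = (1/(2α√π)) ∫_{λ_-}^{λ_+} x^{-1/2} erf((α/2)√((λ_+ - x)(x - λ_-)/x)) dx holds, where λ_± = (√(ϱ+1) ± 1)². -/

import Mathlib

open Real

/-- Modified Bessel function of the first kind `I_ν`, defined by its power series. -/
noncomputable def besselI (ν x : ℝ) : ℝ :=
  ∑' k : ℕ, (x / 2) ^ (2 * (k : ℝ) + ν) / ((Nat.factorial k : ℝ) * Real.Gamma (ν + k + 1))

/-- The coefficient `c(α) = e^{-α²/2} (I₀(α²/2) + I₁(α²/2))`. -/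
noncomputable def cWeak (α : ℝ) : ℝ :=
  Real.exp (-α ^ 2 / 2) * (besselI 0 (α ^ 2 / 2) + besselI 1 (α ^ 2 / 2))

/-- The error function `erf(x) = (2/√π) ∫₀ˣ e^{-t²} dt`. -/
noncomputable def erf (x : ℝ) : ℝ :=
  2 / Real.sqrt Real.pi * ∫ t in (0 : ℝ)..x, Real.exp (-t ^ 2)


lemma cos_pow_odd (n : ℕ) : ∫ x in (0:ℝ)..(2*π), cos x ^ (2*n+1) = 0 := by
  induction n with
  | zero => simp
  | succ k ih =>
    rw [show 2*(k+1)+1 = (2*k+1)+2 by ring, integral_cos_pow, ih]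
    simp

lemma cos_pow_even (n : ℕ) : ∫ x in (0:ℝ)..(2*π), cos x ^ (2*n) =
    2 * π * ((2*n).factorial / (4^n * (n.factorial:ℝ)^2)) := by
  induction n with
  | zero => simp
  | succ k ih =>
    rw [show 2*(k+1) = (2*k)+2 by ring, integral_cos_pow, ih]
    simp only [Nat.factorial_succ, sin_two_pi, sin_zero]
    push_cast
    field_simp
    ring

lemma exp_cos_hasSum (z : ℝ) (m : ℕ) :
    HasSum (fun n : ℕ => z ^ n / n.factorial * ∫ x in (0:ℝ)..(2*π), cos x ^ (n + m))
      (∫ x in (0:ℝ)..(2*π), cos x ^ m * exp (z * cos x)) := by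
  have h := intervalIntegral.hasSum_integral_of_dominated_convergence (μ := MeasureTheory.volume)
    (a := 0) (b := 2 * π)
    (F := fun (n : ℕ) (x : ℝ) => z ^ n / n.factorial * cos x ^ (n + m))
    (f := fun x => cos x ^ m * exp (z * cos x))
    (fun n _ => |z| ^ n / n.factorial)
    (fun n => Continuous.aestronglyMeasurable (by fun_prop))
    (fun n => Filter.Eventually.of_forall fun x _ => by
      rw [norm_mul, norm_div, norm_pow, norm_pow]
      simp only [Real.norm_eq_abs, Nat.abs_cast]
      have : |cos x| ^ (n + m) ≤ 1 := pow_le_one₀ (abs_nonneg _) (abs_cos_le_one x)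
      exact mul_le_of_le_one_right (by positivity) this)
    (Filter.Eventually.of_forall fun x _ => Real.summable_pow_div_factorial _)
    intervalIntegrable_const
    (Filter.Eventually.of_forall fun x _ => by
      have h1 : HasSum (fun n : ℕ => (z * cos x) ^ n / n.factorial) (exp (z * cos x)) := by
        rw [Real.exp_eq_exp_ℝ]
        exact NormedSpace.expSeries_div_hasSum_exp (z * cos x)
      have := h1.mul_left (cos x ^ m)
      refine this.congr_fun ?_ |> id
      intro n
      ring)
  simpa using h

lemma bessel0 (z : ℝ) (hz : 0 < z) :
    besselI 0 z = 1 / (2 * π) * ∫ x in (0:ℝ)..(2*π), exp (z * cos x) := by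
  have h := (exp_cos_hasSum z 0).mul_left (1 / (2*π))
  simp only [pow_zero, one_mul, add_zero] at h
  have hi : Function.Injective (fun k : ℕ => 2 * k) := fun a b h => by simpa using h
  rw [← hi.hasSum_iff] at h
  · rw [← h.tsum_eq, besselI]
    congr 1
    ext k
    simp only [Function.comp]
    rw [cos_pow_even, zero_add, add_zero, Real.Gamma_nat_eq_factorial,
      show (2 * (k:ℝ)) = ((2 * k : ℕ) : ℝ) by push_cast; ring, Real.rpow_natCast, div_pow,
      pow_mul 2]
    have := Real.pi_ne_zero
    field_simp
    norm_num
  · intro n hn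
    rcases Nat.even_or_odd' n with ⟨k, rfl | rfl⟩
    · exact absurd ⟨k, rfl⟩ hn
    · rw [cos_pow_odd]; simp

lemma bessel1 (z : ℝ) (hz : 0 < z) :
    besselI 1 z = 1 / (2 * π) * ∫ x in (0:ℝ)..(2*π), cos x * exp (z * cos x) := by
  have h := (exp_cos_hasSum z 1).mul_left (1 / (2*π))
  simp only [pow_one] at h
  have hi : Function.Injective (fun k : ℕ => 2 * k + 1) := fun a b h => by simpa using h
  rw [← hi.hasSum_iff] at h
  · rw [← h.tsum_eq, besselI]
    congr 1
    ext k
    simp only [Function.comp]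
    rw [show 2 * k + 1 + 1 = 2 * (k + 1) by ring, cos_pow_even,
      show (1 + (k:ℝ) + 1) = ((k + 1 : ℕ) : ℝ) + 1 by push_cast; ring,
      Real.Gamma_nat_eq_factorial,
      show (2 * (k:ℝ) + 1) = ((2 * k + 1 : ℕ) : ℝ) by push_cast; ring, Real.rpow_natCast, div_pow,
      pow_succ 2, pow_mul 2, show 2 * (k + 1) = 2 * k + 1 + 1 by ring, Nat.factorial_succ (2*k+1),
      Nat.factorial_succ k]
    have := Real.pi_ne_zero
    push_cast
    field_simp
    ring
  · intro n hn
    rcases Nat.even_or_odd' n with ⟨k, rfl | rfl⟩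
    · rw [cos_pow_odd]; simp
    · exact absurd ⟨k, rfl⟩ hn

lemma cWeak_eq (α : ℝ) (hα : 0 < α) :
    cWeak α = 2 / π * ∫ x in (0:ℝ)..π, cos x ^ 2 * exp (-(α * sin x) ^ 2) := by
  have hz : 0 < α ^ 2 / 2 := by positivity
  have h2 := intervalIntegral.integral_comp_mul_left (a := 0) (b := π)
    (fun x => exp (-α ^ 2 / 2) * ((1 + cos x) * exp (α ^ 2 / 2 * cos x))) (c := 2) two_ne_zero
  have h3 : ∀ x, exp (-α ^ 2 / 2) * ((1 + cos (2 * x)) * exp (α ^ 2 / 2 * cos (2 * x))) =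
      2 * (cos x ^ 2 * exp (-(α * sin x) ^ 2)) := by
    intro x
    rw [mul_left_comm, ← exp_add, cos_two_mul, mul_pow, sin_sq]
    ring_nf
  simp only [h3] at h2
  rw [intervalIntegral.integral_const_mul, intervalIntegral.integral_const_mul] at h2
  rw [cWeak, bessel0 _ hz, bessel1 _ hz, ← mul_add, ← intervalIntegral.integral_add
    (Continuous.intervalIntegrable (by fun_prop) _ _)
    (Continuous.intervalIntegrable (by fun_prop) _ _)]
  have h4 : ∀ x, exp (α ^ 2 / 2 * cos x) + cos x * exp (α ^ 2 / 2 * cos x) =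
    (1 + cos x) * exp (α ^ 2 / 2 * cos x) := fun x => by ring
  simp only [h4]
  simp only [smul_eq_mul, mul_zero] at h2
  have := Real.pi_ne_zero
  field_simp
  field_simp at h2
  linarith

lemma erf_deriv (x : ℝ) : HasDerivAt erf (2 / √π * exp (-x ^ 2)) x := by
  have hc : Continuous fun t : ℝ => exp (-t ^ 2) := by fun_prop
  exact ((hc.integral_hasStrictDerivAt 0 x).hasDerivAt).const_mul _

lemma erf_cont : Continuous erf :=
  continuous_iff_continuousAt.2 fun x => (erf_deriv x).continuousAt

lemma cWeak_eq' (α : ℝ) (hα : 0 < α) :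
    cWeak α = 1 / (α * √π) * ∫ x in (0:ℝ)..π, erf (α * sin x) * sin x := by
  have h := intervalIntegral.integral_mul_deriv_eq_deriv_mul (a := 0) (b := π)
    (u := fun x => erf (α * sin x)) (v := fun x => - cos x) (v' := sin)
    (u' := fun x => 2 / √π * exp (-(α * sin x) ^ 2) * (α * cos x))
    (fun x _ => HasDerivAt.comp (h₂ := erf) (h := fun x => α * sin x) x (erf_deriv (α * sin x))
      ((hasDerivAt_sin x).const_mul α))
    (fun x _ => by simpa using (hasDerivAt_cos x).fun_neg)
    (Continuous.intervalIntegrable (by fun_prop) _ _)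
    (Continuous.intervalIntegrable (by fun_prop) _ _)
  have e0 : erf 0 = 0 := by simp [erf]
  rw [cWeak_eq α hα, h]
  have h3 : ∀ x, 2 / √π * exp (-(α * sin x) ^ 2) * (α * cos x) * (- cos x) =
     (-(2 * α / √π)) * (cos x ^ 2 * exp (-(α * sin x) ^ 2)) := fun x => by ring
  simp only [h3, sin_pi, sin_zero, mul_zero, e0, zero_mul, sub_zero]
  rw [intervalIntegral.integral_const_mul]
  have : √π ≠ 0 := by positivity
  have h5 : √π * √π = π := Real.mul_self_sqrt Real.pi_pos.le
  generalize (∫ x in (0:ℝ)..π, cos x ^ 2 * exp (-(α * sin x) ^ 2)) = J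
  have h6 : 2 / π = 2 / (√π * √π) := by rw [h5]
  rw [h6]
  field_simp
  ring

lemma refl_even (F : ℝ → ℝ) (hF : Continuous F) (h : ∀ x, F (π - x) = F x) :
    2 * ∫ x in (π/2)..π, F x = ∫ x in (0:ℝ)..π, F x := by
  have h1 := intervalIntegral.integral_comp_sub_left (a := π/2) (b := π) F π
  simp only [h, sub_self, show π - π / 2 = π / 2 by ring] at h1
  rw [← intervalIntegral.integral_add_adjacent_intervals (a := 0) (b := π/2) (c := π)
    (hF.intervalIntegrable _ _) (hF.intervalIntegrable _ _)]
  linarith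

lemma refl_odd (F : ℝ → ℝ) (h : ∀ x, F (π - x) = - F x) :
    ∫ x in (0:ℝ)..π, F x = 0 := by
  have h1 := intervalIntegral.integral_comp_sub_left (a := 0) (b := π) F π
  simp only [h, sub_self, sub_zero, intervalIntegral.integral_neg] at h1
  linarith

lemma case_pos (s α : ℝ) (hs : 1 < s) :
    ∫ x in ((s - 1) ^ 2)..((s + 1) ^ 2),
        x ^ (-(1 / 2 : ℝ)) * erf (α / 2 * √(((s + 1) ^ 2 - x) * (x - (s - 1) ^ 2) / x)) =
    2 * ∫ x in (0:ℝ)..π, erf (α * sin x) * sin x := by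
  have hr : 0 < s ^ 2 - 1 := by nlinarith
  set r := s ^ 2 - 1 with hrdef
  have hq : ∀ t, 0 < cos t ^ 2 + r := fun t => by positivity
  have hQ : ∀ t, √(cos t ^ 2 + r) ^ 2 = cos t ^ 2 + r := fun t => Real.sq_sqrt (hq t).le
  have hQp : ∀ t, 0 < √(cos t ^ 2 + r) := fun t => Real.sqrt_pos.2 (hq t)
  have hy : ∀ t, 0 < -cos t + √(cos t ^ 2 + r) := fun t => by
    have : cos t < √(cos t ^ 2 + r) := by
      apply Real.lt_sqrt_of_sq_lt; linarith
    linarith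
  have hd : ∀ t, HasDerivAt (fun t => (-cos t + √(cos t ^ 2 + r)) ^ 2)
      (2 * (-cos t + √(cos t ^ 2 + r)) * (sin t * (1 - cos t / √(cos t ^ 2 + r)))) t := by
    intro t
    have h1 := ((((hasDerivAt_cos t).fun_pow 2).add_const r).sqrt (hq t).ne')
    have h2 := ((hasDerivAt_cos t).fun_neg.fun_add h1).fun_pow 2
    refine h2.congr_deriv ?_
    have := (hQp t).ne'
    push_cast
    field_simp
    ring
  have e0 : (-cos 0 + √(cos 0 ^ 2 + r)) ^ 2 = (s - 1) ^ 2 := by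
    rw [cos_zero, show (1:ℝ) ^ 2 + r = s ^ 2 by rw [hrdef]; ring, Real.sqrt_sq (by linarith)]; ring
  have e1 : (-cos π + √(cos π ^ 2 + r)) ^ 2 = (s + 1) ^ 2 := by
    rw [cos_pi, show (-1:ℝ) ^ 2 + r = s ^ 2 by rw [hrdef]; ring, Real.sqrt_sq (by linarith)]; ring
  have hc : ∀ t, √(cos t ^ 2 + r) ≠ 0 := fun t => (hQp t).ne'
  have key := intervalIntegral.integral_comp_mul_deriv' (a := 0) (b := π)
    (f := fun t => (-cos t + √(cos t ^ 2 + r)) ^ 2)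
    (f' := fun t => 2 * (-cos t + √(cos t ^ 2 + r)) * (sin t * (1 - cos t / √(cos t ^ 2 + r))))
    (g := fun x => x ^ (-(1 / 2 : ℝ)) * erf (α / 2 * √(((s + 1) ^ 2 - x) * (x - (s - 1) ^ 2) / x)))
    (fun t _ => hd t)
    (Continuous.continuousOn (by fun_prop (disch := exact hc _)))
    (by
      rintro _ ⟨t, -, rfl⟩
      have hx : (-cos t + √(cos t ^ 2 + r)) ^ 2 ≠ 0 := (pow_pos (hy t) 2).ne'
      apply ContinuousAt.continuousWithinAt
      apply ContinuousAt.mul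
      · exact Real.continuousAt_rpow_const _ _ (Or.inl hx)
      · apply erf_cont.continuousAt.comp
        exact continuousAt_const.mul (Real.continuous_sqrt.continuousAt.comp
          (ContinuousAt.div (by fun_prop) (by fun_prop) hx)))
  simp only [e0, e1] at key
  rw [← key]
  have hcongr : ∀ t ∈ Set.uIcc 0 π,
      ((fun x => x ^ (-(1 / 2 : ℝ)) *
        erf (α / 2 * √(((s + 1) ^ 2 - x) * (x - (s - 1) ^ 2) / x))) ∘
        (fun t => (-cos t + √(cos t ^ 2 + r)) ^ 2)) t *
        (2 * (-cos t + √(cos t ^ 2 + r)) * (sin t * (1 - cos t / √(cos t ^ 2 + r)))) =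
      2 * (erf (α * sin t) * sin t) -
        2 * (erf (α * sin t) * sin t * (cos t / √(cos t ^ 2 + r))) := by
    intro t ht
    rw [Set.uIcc_of_le Real.pi_pos.le] at ht
    have hsin := sin_nonneg_of_mem_Icc ht
    simp only [Function.comp]
    have hE : ((s + 1) ^ 2 - (-cos t + √(cos t ^ 2 + r)) ^ 2) *
        ((-cos t + √(cos t ^ 2 + r)) ^ 2 - (s - 1) ^ 2) / (-cos t + √(cos t ^ 2 + r)) ^ 2 =
        (2 * sin t) ^ 2 := by
      have hYY : (-cos t + √(cos t ^ 2 + r)) ^ 2 =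
        r - 2 * cos t * (-cos t + √(cos t ^ 2 + r)) := by nlinarith [hQ t]
      have hY := hy t
      generalize -cos t + √(cos t ^ 2 + r) = Y at *
      rw [div_eq_iff (pow_pos hY 2).ne', mul_pow, sin_sq]
      have hss : s ^ 2 = r + 1 := by rw [hrdef]; ring
      have : ((s + 1) ^ 2 - Y ^ 2) * (Y ^ 2 - (s - 1) ^ 2) = 4 * Y ^ 2 - (Y ^ 2 - r) ^ 2 := by
        rw [hrdef]; ring
      rw [this]
      have h3 : Y ^ 2 - r = - (2 * cos t * Y) := by linarith
      rw [h3]; ring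
    have hP : ((-cos t + √(cos t ^ 2 + r)) ^ 2) ^ (-(1 / 2 : ℝ)) =
        (-cos t + √(cos t ^ 2 + r))⁻¹ := by
      rw [Real.rpow_neg (sq_nonneg _), ← Real.sqrt_eq_rpow, Real.sqrt_sq (hy t).le]
    rw [hE, hP, Real.sqrt_sq (by linarith), show α / 2 * (2 * sin t) = α * sin t by ring]
    have := (hy t).ne'
    field_simp
  rw [intervalIntegral.integral_congr hcongr]
  have ec := erf_cont
  rw [intervalIntegral.integral_sub
    (Continuous.intervalIntegrable (by fun_prop) _ _)
    (Continuous.intervalIntegrable (by fun_prop (disch := exact hc _)) _ _),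
    intervalIntegral.integral_const_mul, intervalIntegral.integral_const_mul,
    refl_odd (fun t => erf (α * sin t) * sin t * (cos t / √(cos t ^ 2 + r)))]
  · ring
  · intro x
    simp only [sin_pi_sub, cos_pi_sub, neg_sq]
    ring

lemma case_zero (α : ℝ) :
    ∫ x in (0:ℝ)..4, x ^ (-(1 / 2 : ℝ)) * erf (α / 2 * √((4 - x) * (x - 0) / x)) =
    2 * ∫ x in (0:ℝ)..π, erf (α * sin x) * sin x := by
  have ec := erf_cont
  have hle : π / 2 ≤ π := by linarith [Real.pi_pos]
  have h1 : ∫ x in (0:ℝ)..4, x ^ (-(1 / 2 : ℝ)) * erf (α / 2 * √((4 - x) * (x - 0) / x)) =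
      ∫ x in (0:ℝ)..4, x ^ (-(1 / 2 : ℝ)) * erf (α / 2 * √(4 - x)) := by
    apply intervalIntegral.integral_congr_ae
    refine Filter.Eventually.of_forall fun x hx => ?_
    rw [Set.uIoc_of_le (by norm_num)] at hx
    have := hx.1.ne'
    rw [sub_zero, mul_div_assoc, div_self this, mul_one]
  rw [h1]
  have hcos : ∀ t ∈ Set.Icc (π/2) π, cos t ≤ 0 := fun t ht =>
    cos_nonpos_of_pi_div_two_le_of_le ht.1 (by linarith [ht.2, Real.pi_pos])
  have hcos' : ∀ t ∈ Set.Ioo (π/2) π, cos t < 0 := fun t ht =>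
    cos_neg_of_pi_div_two_lt_of_lt ht.1 (by linarith [ht.2, Real.pi_pos])
  have hcongr : ∀ t ∈ Set.Ioc (π/2) π,
      ((fun x => x ^ (-(1 / 2 : ℝ)) * erf (α / 2 * √(4 - x))) ∘ (fun t => 4 * cos t ^ 2)) t *
        (- (8 * cos t * sin t)) = 4 * (erf (α * sin t) * sin t) := by
    intro t ht
    have hs : 0 ≤ sin t := sin_nonneg_of_mem_Icc ⟨by linarith [ht.1, Real.pi_pos], ht.2⟩
    have hct : cos t < 0 :=
      cos_neg_of_pi_div_two_lt_of_lt ht.1 (by linarith [ht.2, Real.pi_pos])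
    simp only [Function.comp]
    have hP : (4 * cos t ^ 2) ^ (-(1 / 2 : ℝ)) = (-(2 * cos t))⁻¹ := by
      rw [Real.rpow_neg (by positivity), ← Real.sqrt_eq_rpow,
        show 4 * cos t ^ 2 = (-(2 * cos t)) ^ 2 by ring, Real.sqrt_sq (by linarith)]
    have hE : 4 - 4 * cos t ^ 2 = (2 * sin t) ^ 2 := by rw [mul_pow, sin_sq]; ring
    rw [hE, hP, Real.sqrt_sq (by linarith), show α / 2 * (2 * sin t) = α * sin t by ring]
    have := hct.ne
    field_simp
    ring
  have hint : IntervalIntegrable (fun x : ℝ => x ^ (-(1 / 2 : ℝ)) * erf (α / 2 * √(4 - x)))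
      MeasureTheory.volume 0 4 :=
    (intervalIntegral.intervalIntegrable_rpow' (by norm_num)).mul_continuousOn
      (Continuous.continuousOn (by fun_prop))
  have key := intervalIntegral.integral_comp_mul_deriv''' (a := π/2) (b := π)
    (f := fun t => 4 * cos t ^ 2)
    (f' := fun t => - (8 * cos t * sin t))
    (g := fun x => x ^ (-(1 / 2 : ℝ)) * erf (α / 2 * √(4 - x)))
    (Continuous.continuousOn (by fun_prop))
    (fun t _ => by
      have h2 := ((hasDerivAt_cos t).fun_pow 2).const_mul 4
      refine (h2.congr_deriv ?_).hasDerivWithinAt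
      push_cast
      ring)
    (by
      rintro _ ⟨t, ht, rfl⟩
      rw [min_eq_left hle, max_eq_right hle] at ht
      have hx : 4 * cos t ^ 2 ≠ 0 := by
        have := (hcos' t ht).ne
        positivity
      apply ContinuousAt.continuousWithinAt
      apply ContinuousAt.mul
      · exact Real.continuousAt_rpow_const _ _ (Or.inl hx)
      · exact Continuous.continuousAt (by fun_prop))
    (by
      rw [intervalIntegrable_iff_integrableOn_Icc_of_le (by norm_num)] at hint
      refine hint.mono_set ?_
      rintro _ ⟨t, ht, rfl⟩
      simp only [Set.mem_Icc]
      constructor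
      · positivity
      · nlinarith [sin_sq_add_cos_sq t, sq_nonneg (sin t)])
    (by
      rw [Set.uIcc_of_le hle, integrableOn_Icc_iff_integrableOn_Ioc]
      refine MeasureTheory.IntegrableOn.congr_fun (f := fun t => 4 * (erf (α * sin t) * sin t))
        ?_ (fun t ht => (hcongr t ht).symm) measurableSet_Ioc
      exact (Continuous.integrableOn_Icc (by fun_prop)).mono_set Set.Ioc_subset_Icc_self)
  simp only [cos_pi, cos_pi_div_two] at key
  norm_num only at key
  norm_num only
  rw [← key]
  rw [← refl_even (fun t => erf (α * sin t) * sin t) (by fun_prop) (fun x => by simp)]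
  rw [← mul_assoc, ← intervalIntegral.integral_const_mul]
  apply intervalIntegral.integral_congr_ae
  refine Filter.Eventually.of_forall fun x hx => ?_
  rw [Set.uIoc_of_le hle] at hx
  have := hcongr x hx
  norm_num only at this ⊢
  exact this

/-- for any `ϱ ≥ 0` and `α > 0`, with `λ± = (√(ϱ+1) ± 1)²`,
`c(α) = (1/(2α√π)) ∫_{λ₋}^{λ₊} x^{-1/2} erf((α/2)√((λ₊-x)(x-λ₋)/x)) dx`. -/
theorem cWeak_integral_identity (ϱ α : ℝ) (hϱ : 0 ≤ ϱ) (hα : 0 < α) :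
    cWeak α = 1 / (2 * α * Real.sqrt Real.pi) *
      ∫ x in ((Real.sqrt (ϱ + 1) - 1) ^ 2)..((Real.sqrt (ϱ + 1) + 1) ^ 2),
        x ^ (-(1 / 2 : ℝ)) *
          erf (α / 2 * Real.sqrt
            (((Real.sqrt (ϱ + 1) + 1) ^ 2 - x) * (x - (Real.sqrt (ϱ + 1) - 1) ^ 2) / x)) := by
  have hmain : ∫ x in ((√(ϱ + 1) - 1) ^ 2)..((√(ϱ + 1) + 1) ^ 2),
        x ^ (-(1 / 2 : ℝ)) * erf (α / 2 * √(((√(ϱ + 1) + 1) ^ 2 - x) *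
          (x - (√(ϱ + 1) - 1) ^ 2) / x)) =
      2 * ∫ x in (0:ℝ)..π, erf (α * sin x) * sin x := by
    rcases hϱ.eq_or_lt with h | h
    · have h1 : √(ϱ + 1) = 1 := by rw [← h]; simp
      rw [h1, show ((1:ℝ) - 1) ^ 2 = 0 by norm_num, show ((1:ℝ) + 1) ^ 2 = 4 by norm_num]
      exact case_zero α
    · exact case_pos _ _ (Real.lt_sqrt_of_sq_lt (by linarith))
  rw [hmain, cWeak_eq' α hα]
  have : √π ≠ 0 := by positivity
  field_simp
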